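/- Let F₂ be the free group with basis {a,b} and let u ∈ F₂ be a primitive element. Then the reversal u^R of u is conjugate to u in F₂; that is, the conjugacy class of a primitive word of F₂ is closed under reversal. -/

import Mathlib

namespace FreeGroup

section CommonPrefix

variable {α : Type*} [DecidableEq α]

/-- The length of the longest common prefix of two lists. -/
def commonPrefixLength : List α → List α → ℕ
  | a :: l, b :: m => if a = b then commonPrefixLength l m + 1 else 0
  | [], _ => 0
  | _ :: _, [] => 0

theorem le_commonPrefixLength_iff (k : ℕ) (l m : List α) :
    k ≤ commonPrefixLength l m ↔ k ≤ l.length ∧ k ≤ m.length ∧ l.take k = m.take k := by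
  induction l generalizing k m with
  | nil => cases m <;> simp +contextual [commonPrefixLength]
  | cons a l ih =>
    cases m with
    | nil => simp +contextual [commonPrefixLength]
    | cons b m =>
      cases k with
      | zero => simp
      | succ k =>
        by_cases h : a = b
        · simp [commonPrefixLength, h, ih]
        · simp [commonPrefixLength, h]

theorem commonPrefixLength_comm (l m : List α) :
    commonPrefixLength l m = commonPrefixLength m l := by
  refine eq_of_forall_le_iff fun k => ?_
  rw [le_commonPrefixLength_iff, le_commonPrefixLength_iff]
  grind

theorem min_commonPrefixLength_le (l m n : List α) :
    min (commonPrefixLength l m) (commonPrefixLength m n) ≤ commonPrefixLength l n := by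
  have h₁ := (le_commonPrefixLength_iff _ l m).1 (min_le_left _ (commonPrefixLength m n))
  have h₂ := (le_commonPrefixLength_iff _ m n).1 (min_le_right (commonPrefixLength l m) _)
  rw [le_commonPrefixLength_iff]
  exact ⟨h₁.1, h₂.2.1, h₁.2.2.trans h₂.2.2⟩

end CommonPrefix

section GromovProduct

variable {α : Type*} [DecidableEq α]

/-- The Gromov product of two elements of a free group, based at `1`, for the word metric: the
length of the longest common prefix of their reduced words. -/
def gromovProduct (x y : FreeGroup α) : ℕ :=
  commonPrefixLength x.toWord y.toWord

theorem gromovProduct_comm (x y : FreeGroup α) : gromovProduct x y = gromovProduct y x :=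
  commonPrefixLength_comm _ _

theorem min_gromovProduct_le (x y z : FreeGroup α) :
    min (gromovProduct x y) (gromovProduct y z) ≤ gromovProduct x z :=
  min_commonPrefixLength_le _ _ _

theorem norm_mk_of_isReduced {L : List (α × Bool)} (h : IsReduced L) :
    norm (mk L) = L.length := by
  rw [norm, toWord_mk, h.reduce_eq]

theorem isReduced_invRev {L : List (α × Bool)} (h : IsReduced L) : IsReduced (invRev L) := by
  rw [isReduced_iff_reduce_eq] at *
  rw [reduce_invRev, h]

theorem norm_inv_mul_mk {L M : List (α × Bool)} (hL : IsReduced L) (hM : IsReduced M) :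
    norm ((mk L)⁻¹ * mk M) + 2 * commonPrefixLength L M = L.length + M.length := by
  induction L generalizing M with
  | nil => simp [commonPrefixLength, ← one_eq_mk, norm_mk_of_isReduced hM]
  | cons a L ih =>
    cases M with
    | nil => simp [commonPrefixLength, ← one_eq_mk, norm_mk_of_isReduced hL, -inv_mk]
    | cons b M =>
      by_cases h : a = b
      · subst h
        have := ih (hL.infix (List.suffix_cons a L).isInfix)
          (hM.infix (List.suffix_cons a M).isInfix)
        have e : (mk (a :: L))⁻¹ * mk (a :: M) = (mk L)⁻¹ * mk M := by
          rw [← List.singleton_append, ← List.singleton_append (l := M), ← mul_mk, ← mul_mk]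
          group
        simp only [e, commonPrefixLength, if_true, List.length_cons]
        lia
      · have hr : IsReduced (invRev (a :: L) ++ b :: M) := by
          have h₁ := isReduced_invRev hL
          rw [invRev_cons] at h₁ ⊢
          refine IsReduced.append_overlap (L₃ := b :: M) h₁ ?_ (by simp [invRev])
          have : invRev [a] ++ b :: M = (a.1, !a.2) :: b :: M := by simp [invRev]
          rw [this, isReduced_cons_cons]
          refine ⟨fun h1 => ?_, hM⟩
          by_contra h2
          apply h
          ext
          · exact h1
          · revert h2
            cases a.2 <;> cases b.2 <;> simp
        rw [inv_mk, mul_mk, norm_mk_of_isReduced hr]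
        simp [commonPrefixLength, h]

theorem norm_inv_mul_add (x y : FreeGroup α) :
    norm (x⁻¹ * y) + 2 * gromovProduct x y = norm x + norm y := by
  have := norm_inv_mul_mk (isReduced_toWord (x := x)) (isReduced_toWord (x := y))
  rw [mk_toWord, mk_toWord] at this
  exact this

theorem norm_mul_add (x y : FreeGroup α) :
    norm (x * y) + 2 * gromovProduct x⁻¹ y = norm x + norm y := by
  simpa using norm_inv_mul_add x⁻¹ y

theorem gromovProduct_self (x : FreeGroup α) : gromovProduct x x = norm x := by
  have := norm_inv_mul_add x x
  simp only [inv_mul_cancel, norm_one] at this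
  lia

theorem norm_lt_norm_mul_self {x : FreeGroup α} (hx : x ≠ 1) : norm x < norm (x * x) := by
  have h := reduceCyclically.conj_conjugator_reduceCyclically x.toWord
  have h₂ := toWord_pow x 2
  rw [reduceCyclically.reduce_flatten_replicate isReduced_toWord] at h₂
  have l₁ := congrArg List.length h
  have l₂ := congrArg List.length h₂
  have hpos : 0 < (reduceCyclically x.toWord).length := by
    rw [List.length_pos_iff]
    intro h₀
    rw [h₀] at h
    apply hx
    rw [← mk_toWord (x := x), ← h, List.append_nil, ← mul_mk, ← inv_mk, mul_inv_cancel]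
  rw [← sq]
  unfold norm
  simp only [List.length_append, invRev_length] at l₁
  simp [List.replicate_succ] at l₂
  lia

theorem two_mul_gromovProduct_inv_self_lt {x : FreeGroup α} (hx : x ≠ 1) :
    2 * gromovProduct x⁻¹ x < norm x := by
  have := norm_lt_norm_mul_self hx
  have := norm_mul_add x x
  lia

end GromovProduct

section NielsenReduced

variable {α β : Type*}

/-- The image of a letter under the homomorphism induced by `g`. -/
def letterImage (g : α → FreeGroup β) (l : α × Bool) : FreeGroup β :=
  cond l.2 (g l.1) (g l.1)⁻¹

theorem lift_mk_cons (g : α → FreeGroup β) (l : α × Bool) (L : List (α × Bool)) :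
    lift g (mk (l :: L)) = letterImage g l * lift g (mk L) := by
  simp [letterImage, lift_mk]

theorem lift_mk_singleton (g : α → FreeGroup β) (l : α × Bool) :
    lift g (mk [l]) = letterImage g l := by
  simp [letterImage, lift_mk]

variable [DecidableEq β]

/-- In the products `z * y` and `y * x` of images of non-inverse letters, the parts of `y` which
are cancelled do not exhaust `y`. -/
def IsNielsenReduced (g : α → FreeGroup β) : Prop :=
  ∀ z y x : α × Bool, (z.1 = y.1 → z.2 = y.2) → (y.1 = x.1 → y.2 = x.2) →
    gromovProduct (letterImage g z)⁻¹ (letterImage g y) +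
      gromovProduct (letterImage g y)⁻¹ (letterImage g x) < norm (letterImage g y)

theorem IsNielsenReduced.gromovProduct_lift_mk_cons {g : α → FreeGroup β}
    (hg : IsNielsenReduced g) (L : List (α × Bool)) (l : α × Bool) (hL : IsReduced (l :: L)) :
    L.length + gromovProduct (lift g (mk (l :: L))) (letterImage g l) ≤
        norm (lift g (mk (l :: L))) ∧
      ∀ z : α × Bool, (z.1 = l.1 → z.2 = l.2) →
        gromovProduct (letterImage g z)⁻¹ (letterImage g l) <
          gromovProduct (lift g (mk (l :: L))) (letterImage g l) := by
  induction L generalizing l with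
  | nil =>
    simp only [lift_mk_singleton, gromovProduct_self]
    refine ⟨by simp, fun z hz => ?_⟩
    have := hg z l l hz (fun _ => rfl)
    lia
  | cons m L ih =>
    rw [isReduced_cons_cons] at hL
    obtain ⟨h₁, h₂⟩ := ih m hL.2
    have hlm := h₂ l hL.1
    rw [lift_mk_cons g l]
    set W := lift g (mk (m :: L))
    set y := letterImage g l
    set x := letterImage g m
    have e₁ := min_gromovProduct_le y⁻¹ x W
    have e₂ := min_gromovProduct_le y⁻¹ W x
    rw [gromovProduct_comm x W] at e₁
    have e₃ := norm_mul_add y W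
    have e₄ := norm_inv_mul_add (y * W) y
    have e₅ : (y * W)⁻¹ * y = W⁻¹ := by group
    rw [e₅, norm_inv_eq] at e₄
    simp only [List.length_cons]
    refine ⟨by lia, fun z hz => ?_⟩
    have := hg z l m hz hL.1
    lia

theorem IsNielsenReduced.length_le_norm {g : α → FreeGroup β} (hg : IsNielsenReduced g)
    {L : List (α × Bool)} (hL : IsReduced L) : L.length ≤ norm (lift g (mk L)) := by
  cases L with
  | nil => simp
  | cons l L =>
    obtain ⟨h₁, h₂⟩ := hg.gromovProduct_lift_mk_cons L l hL
    have := h₂ l (fun _ => rfl)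
    simp only [List.length_cons]
    lia

end NielsenReduced

section Conjugation

variable {α : Type*} [DecidableEq α]

theorem exists_conj_norm_add_lt {u v : FreeGroup α} (hv : v ≠ 1) (hle : norm v ≤ norm u)
    (h₁ : 2 * gromovProduct u⁻¹ v = norm v) (h₂ : 2 * gromovProduct v⁻¹ u = norm v) :
    ∃ t : FreeGroup α,
      norm (t⁻¹ * (u * v) * t) + norm (t⁻¹ * v * t) < norm u + norm v := by
  obtain ⟨-, -, p₁⟩ := (le_commonPrefixLength_iff _ _ _).1 (le_refl (gromovProduct u⁻¹ v))
  obtain ⟨-, -, p₂⟩ := (le_commonPrefixLength_iff _ _ _).1 (le_refl (gromovProduct v⁻¹ u))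
  have hk : gromovProduct u⁻¹ v = gromovProduct v⁻¹ u := by lia
  rw [hk] at p₁
  set k := gromovProduct v⁻¹ u
  have hpos : norm v ≠ 0 := fun h => hv (norm_eq_zero.1 h)
  set N := v⁻¹.toWord with hN
  have hNlen : N.length = 2 * k := by
    rw [hN, ← norm, norm_inv_eq, h₂]
  have hvN : v.toWord = invRev (N.drop k) ++ invRev (N.take k) := by
    rw [← invRev_append, List.take_append_drop, hN, toWord_inv, invRev_invRev]
  have hS : v.toWord.take k = invRev (N.drop k) := by
    rw [hvN, List.take_left']
    rw [invRev_length, List.length_drop]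
    lia
  have hU₁ : u.toWord = N.take k ++ u.toWord.drop k := by
    rw [p₂, List.take_append_drop]
  have hU₂ : u.toWord = invRev (u⁻¹.toWord.drop k) ++ N.drop k := by
    apply invRev_injective
    rw [invRev_append, invRev_invRev, ← hS, ← p₁, List.take_append_drop, toWord_inv]
  have hUlen : u.toWord.length = norm u := rfl
  obtain ⟨Z, hZ⟩ : ∃ Z, u.toWord.drop k = Z ++ N.drop k := by
    have hsuf : N.drop k <:+ u.toWord := ⟨_, hU₂.symm⟩
    obtain ⟨Z, hZ⟩ := List.suffix_of_suffix_length_le hsuf (List.drop_suffix k u.toWord) (by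
      rw [List.length_drop, List.length_drop]
      lia)
    exact ⟨Z, hZ.symm⟩
  rw [hZ] at hU₁
  have hu : u = mk (N.take k) * (mk Z * mk (N.drop k)) := by
    rw [mul_mk, mul_mk, ← hU₁, mk_toWord]
  have hv' : v = (mk (N.drop k))⁻¹ * (mk (N.take k))⁻¹ := by
    rw [inv_mk, inv_mk, mul_mk, ← hvN, mk_toWord]
  have hlen := congrArg List.length hU₁
  simp only [List.length_append, List.length_take, List.length_drop] at hlen
  refine ⟨mk (N.take k), ?_⟩
  have e₁ : (mk (N.take k))⁻¹ * (u * v) * mk (N.take k) = mk Z := by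
    rw [hu, hv']
    group
  have e₂ : (mk (N.take k))⁻¹ * v * mk (N.take k) =
      (mk (N.take k))⁻¹ * (mk (N.drop k))⁻¹ := by
    rw [hv']
    group
  have l₁ : norm (mk Z) ≤ Z.length := norm_mk_le
  have l₂ := norm_mul_le (mk (N.take k))⁻¹ (mk (N.drop k))⁻¹
  rw [norm_inv_eq, norm_inv_eq] at l₂
  have l₃ : norm (mk (N.take k)) ≤ (N.take k).length := norm_mk_le
  have l₄ : norm (mk (N.drop k)) ≤ (N.drop k).length := norm_mk_le
  rw [List.length_take] at l₃
  rw [List.length_drop] at l₄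
  rw [e₁, e₂]
  lia

end Conjugation

section Reversal

variable {α : Type*}

/-- The endomorphism of a free group inverting every generator. -/
def invGenerators : FreeGroup α →* FreeGroup α :=
  lift fun i => (of i)⁻¹

@[simp]
theorem invGenerators_of (i : α) : invGenerators (of i) = (of i)⁻¹ :=
  lift_apply_of

theorem mk_reverse (L : List (α × Bool)) : mk L.reverse = (invGenerators (mk L))⁻¹ := by
  induction L with
  | nil => simp [← one_eq_mk]
  | cons l L ih =>
    have h : (invGenerators (mk [l]))⁻¹ = mk [l] := by
      obtain ⟨i, b⟩ := l
      cases b <;> simp [invGenerators, of, invRev]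
    have e : mk (l :: L) = mk [l] * mk L := by simp
    rw [List.reverse_cons, ← mul_mk, ih, e, _root_.map_mul, mul_inv_rev, h]

/-- The reversals of `u` and of `v` are conjugate to `u` and to `v` by a common element. -/
def IsReversalConj (u v : FreeGroup α) : Prop :=
  ∃ c, (invGenerators u)⁻¹ = c * u * c⁻¹ ∧ (invGenerators v)⁻¹ = c * v * c⁻¹

theorem IsReversalConj.swap {u v : FreeGroup α} (h : IsReversalConj u v) :
    IsReversalConj v u := by
  obtain ⟨c, h₁, h₂⟩ := h
  exact ⟨c, h₂, h₁⟩

theorem IsReversalConj.inv_left {u v : FreeGroup α} (h : IsReversalConj u v) :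
    IsReversalConj u⁻¹ v := by
  obtain ⟨c, h₁, h₂⟩ := h
  refine ⟨c, ?_, h₂⟩
  rw [_root_.map_inv, h₁]
  group

theorem IsReversalConj.mul_left {u v : FreeGroup α} (h : IsReversalConj u v) :
    IsReversalConj (u * v) v := by
  obtain ⟨c, h₁, h₂⟩ := h
  refine ⟨c * v, ?_, ?_⟩
  · rw [_root_.map_mul, mul_inv_rev, h₁, h₂]
    group
  · rw [h₂]
    group

theorem IsReversalConj.conj {u v : FreeGroup α} (h : IsReversalConj u v) (t : FreeGroup α) :
    IsReversalConj (t⁻¹ * u * t) (t⁻¹ * v * t) := by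
  obtain ⟨c, h₁, h₂⟩ := h
  have key : ∀ x : FreeGroup α, (invGenerators x)⁻¹ = c * x * c⁻¹ →
      (invGenerators (t⁻¹ * x * t))⁻¹ =
        ((invGenerators t)⁻¹ * c * t) * (t⁻¹ * x * t) * ((invGenerators t)⁻¹ * c * t)⁻¹ := by
    intro x hx
    have : (invGenerators (t⁻¹ * x * t))⁻¹ =
        (invGenerators t)⁻¹ * (invGenerators x)⁻¹ * invGenerators t := by
      simp only [_root_.map_mul, _root_.map_inv]
      group
    rw [this, hx]
    group
  exact ⟨_, key u h₁, key v h₂⟩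

end Reversal

section MinimalCounterexample

/-- A generating pair which is not conjugate to its reversal. -/
def IsCounterexample (u v : FreeGroup (Fin 2)) : Prop :=
  Subgroup.closure {u, v} = ⊤ ∧ ¬ IsReversalConj u v

theorem IsCounterexample.of_mem {u v u' v' : FreeGroup (Fin 2)} (h : IsCounterexample u v)
    (hu : u ∈ Subgroup.closure {u', v'}) (hv : v ∈ Subgroup.closure {u', v'})
    (h' : IsReversalConj u' v' → IsReversalConj u v) : IsCounterexample u' v' := by
  refine ⟨top_le_iff.1 (h.1.symm.le.trans ((Subgroup.closure_le _).2 ?_)), fun H => h.2 (h' H)⟩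
  rintro x (rfl | rfl)
  · exact hu
  · exact hv

theorem left_mem_closure_pair {G : Type*} [Group G] (x y : G) :
    x ∈ Subgroup.closure {x, y} :=
  Subgroup.subset_closure (Set.mem_insert _ _)

theorem right_mem_closure_pair {G : Type*} [Group G] (x y : G) :
    y ∈ Subgroup.closure {x, y} :=
  Subgroup.subset_closure (Set.mem_insert_of_mem _ rfl)

theorem IsCounterexample.swap {u v : FreeGroup (Fin 2)} (h : IsCounterexample u v) :
    IsCounterexample v u :=
  h.of_mem (right_mem_closure_pair v u) (left_mem_closure_pair v u) IsReversalConj.swap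

theorem IsCounterexample.inv_left {u v : FreeGroup (Fin 2)} (h : IsCounterexample u v) :
    IsCounterexample u⁻¹ v := by
  refine h.of_mem ?_ (right_mem_closure_pair _ v) fun H => by simpa using H.inv_left
  simpa using inv_mem (left_mem_closure_pair u⁻¹ v)

theorem IsCounterexample.mul_left {u v : FreeGroup (Fin 2)} (h : IsCounterexample u v) :
    IsCounterexample (u * v) v := by
  refine h.of_mem ?_ (right_mem_closure_pair _ v) fun H => ?_
  · simpa using mul_mem (left_mem_closure_pair (u * v) v)
      (inv_mem (right_mem_closure_pair (u * v) v))
  · simpa using H.swap.inv_left.swap.mul_left.swap.inv_left.swap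

theorem IsCounterexample.conj {u v : FreeGroup (Fin 2)} (h : IsCounterexample u v)
    (t : FreeGroup (Fin 2)) : IsCounterexample (t⁻¹ * u * t) (t⁻¹ * v * t) := by
  refine ⟨?_, fun H => h.2 ?_⟩
  · have := congrArg (Subgroup.map (MulAut.conj t⁻¹).toMonoidHom) h.1
    rw [MonoidHom.map_closure, Subgroup.map_top_of_surjective _ (MulAut.conj t⁻¹).surjective,
      Set.image_pair] at this
    simpa using this
  · have := H.conj t⁻¹
    have e : ∀ x : FreeGroup (Fin 2), t⁻¹⁻¹ * (t⁻¹ * x * t) * t⁻¹ = x := fun x => by group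
    rwa [e, e] at this

/-- A counterexample of minimal total length. -/
def IsMinimalCounterexample (u v : FreeGroup (Fin 2)) : Prop :=
  IsCounterexample u v ∧ ∀ u' v', IsCounterexample u' v' → norm u + norm v ≤ norm u' + norm v'

theorem IsCounterexample.exists_minimal {u v : FreeGroup (Fin 2)} (h : IsCounterexample u v) :
    ∃ u' v', IsMinimalCounterexample u' v' := by
  classical
  have hex : ∃ n, ∃ u' v', IsCounterexample u' v' ∧ norm u' + norm v' = n := ⟨_, u, v, h, rfl⟩
  obtain ⟨u', v', h', hn⟩ := Nat.find_spec hex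
  refine ⟨u', v', h', fun u'' v'' h'' => ?_⟩
  rw [hn]
  exact Nat.find_min' hex ⟨u'', v'', h'', rfl⟩

namespace IsMinimalCounterexample

variable {u v : FreeGroup (Fin 2)}

theorem swap (h : IsMinimalCounterexample u v) : IsMinimalCounterexample v u :=
  ⟨h.1.swap, fun u' v' h' => by simpa [add_comm] using h.2 u' v' h'⟩

theorem inv_left (h : IsMinimalCounterexample u v) : IsMinimalCounterexample u⁻¹ v :=
  ⟨h.1.inv_left, fun u' v' h' => by simpa using h.2 u' v' h'⟩

theorem inv_right (h : IsMinimalCounterexample u v) : IsMinimalCounterexample u v⁻¹ :=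
  h.swap.inv_left.swap

theorem norm_left_le (h : IsMinimalCounterexample u v) : norm u ≤ norm (u * v) := by
  have := h.2 _ _ h.1.mul_left
  lia

theorem norm_right_le (h : IsMinimalCounterexample u v) : norm v ≤ norm (u * v) := by
  have := h.swap.inv_left.inv_right.norm_left_le
  rwa [← mul_inv_rev, norm_inv_eq, norm_inv_eq] at this

theorem right_ne_one (h : IsMinimalCounterexample u v) : v ≠ 1 := by
  rintro rfl
  have hle : Subgroup.closure {u, 1} ≤ Subgroup.zpowers u := by
    rw [Subgroup.closure_le]
    rintro x (rfl | rfl)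
    · exact Subgroup.mem_zpowers x
    · exact one_mem _
  rw [h.1.1] at hle
  obtain ⟨m, hm⟩ := hle (Subgroup.mem_top (of 0))
  obtain ⟨n, hn⟩ := hle (Subgroup.mem_top (of 1))
  have : (of 0 * of 1 : FreeGroup (Fin 2)) = of 1 * of 0 := by
    rw [← hm, ← hn]
    exact zpow_mul_comm u m n
  revert this
  decide

theorem two_mul_gromovProduct_le_right (h : IsMinimalCounterexample u v) :
    2 * gromovProduct u⁻¹ v ≤ norm v := by
  have := h.norm_left_le
  have := norm_mul_add u v
  lia

theorem two_mul_gromovProduct_le_left (h : IsMinimalCounterexample u v) :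
    2 * gromovProduct u⁻¹ v ≤ norm u := by
  have := h.norm_right_le
  have := norm_mul_add u v
  lia

theorem gromovProduct_add_lt (h : IsMinimalCounterexample u v) :
    gromovProduct u⁻¹ v + gromovProduct v⁻¹ u < norm v := by
  have h₁ := h.two_mul_gromovProduct_le_right
  have h₂ := h.swap.two_mul_gromovProduct_le_left
  by_contra! hlt
  have h₃ := h.two_mul_gromovProduct_le_left
  obtain ⟨t, ht⟩ := exists_conj_norm_add_lt (u := u) (v := v) h.right_ne_one
    (by lia) (by lia) (by lia)
  have := h.2 _ _ (h.1.mul_left.conj t)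
  lia

theorem gromovProduct_inv_add_lt (h : IsMinimalCounterexample u v) :
    gromovProduct u v + gromovProduct v⁻¹ u < norm v := by
  have h₁ := h.inv_left.two_mul_gromovProduct_le_right
  have h₂ := h.swap.two_mul_gromovProduct_le_left
  have h₃ := two_mul_gromovProduct_inv_self_lt h.right_ne_one
  have h₄ := min_gromovProduct_le v⁻¹ u v
  rw [inv_inv] at h₁
  lia

theorem gromovProduct_inv_self_add_lt (h : IsMinimalCounterexample u v) :
    gromovProduct v⁻¹ v + gromovProduct v⁻¹ u < norm v := by
  have h₁ := two_mul_gromovProduct_inv_self_lt h.right_ne_one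
  have h₂ := h.swap.two_mul_gromovProduct_le_left
  lia

theorem add_gromovProduct_inv_self_lt (h : IsMinimalCounterexample u v) :
    gromovProduct u⁻¹ v + gromovProduct v⁻¹ v < norm v := by
  have h₁ := two_mul_gromovProduct_inv_self_lt h.right_ne_one
  have h₂ := h.two_mul_gromovProduct_le_right
  lia

theorem letterImage (h : IsMinimalCounterexample u v) {l m : Fin 2 × Bool} (hlm : l.1 ≠ m.1) :
    IsMinimalCounterexample (FreeGroup.letterImage ![u, v] l)
      (FreeGroup.letterImage ![u, v] m) := by
  obtain ⟨i, b⟩ := l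
  obtain ⟨j, c⟩ := m
  fin_cases i <;> fin_cases j <;> cases b <;> cases c <;>
    first
    | exact absurd rfl hlm
    | exact h
    | exact h.inv_left
    | exact h.inv_right
    | exact h.inv_left.inv_right
    | exact h.swap
    | exact h.swap.inv_left
    | exact h.swap.inv_right
    | exact h.swap.inv_left.inv_right

theorem isNielsenReduced (h : IsMinimalCounterexample u v) : IsNielsenReduced ![u, v] := by
  intro z y x hzy hyx
  by_cases hz : z.1 = y.1
  · obtain rfl : z = y := Prod.ext hz (hzy hz)
    by_cases hx : z.1 = x.1
    · obtain rfl : z = x := Prod.ext hx (hyx hx)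
      obtain ⟨w, hw⟩ : ∃ w : Fin 2 × Bool, w.1 ≠ z.1 := ⟨(z.1 + 1, true), by simp⟩
      have := two_mul_gromovProduct_inv_self_lt (h.letterImage hw).right_ne_one
      lia
    · exact (h.letterImage (Ne.symm hx)).gromovProduct_inv_self_add_lt
  · by_cases hx : y.1 = x.1
    · obtain rfl : y = x := Prod.ext hx (hyx hx)
      exact (h.letterImage hz).add_gromovProduct_inv_self_lt
    · have hzx : z.1 = x.1 := by lia
      have H := h.letterImage (l := x) (m := y) (Ne.symm hx)
      by_cases hb : z.2 = x.2
      · obtain rfl : z = x := Prod.ext hzx hb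
        exact H.gromovProduct_add_lt
      · have : FreeGroup.letterImage ![u, v] z = (FreeGroup.letterImage ![u, v] x)⁻¹ := by
          obtain ⟨i, b⟩ := z
          obtain ⟨j, c⟩ := x
          obtain rfl : i = j := hzx
          cases b <;> cases c <;> simp_all [FreeGroup.letterImage]
        rw [this, inv_inv]
        exact H.gromovProduct_inv_add_lt

theorem exists_letterImage_eq_of (h : IsMinimalCounterexample u v) (i : Fin 2) :
    ∃ l, FreeGroup.letterImage ![u, v] l = of i := by
  have hsurj : (lift ![u, v] : FreeGroup (Fin 2) →* FreeGroup (Fin 2)).range = ⊤ := by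
    rw [range_lift_eq_closure, Matrix.range_cons_cons_empty]
    exact h.1.1
  obtain ⟨w, hw⟩ := MonoidHom.range_eq_top.1 hsurj (of i)
  have hlen := h.isNielsenReduced.length_le_norm (isReduced_toWord (x := w))
  rw [mk_toWord, hw, norm_of] at hlen
  rw [← mk_toWord (x := w)] at hw
  match hL : w.toWord with
  | [] =>
    rw [hL, ← one_eq_mk, _root_.map_one] at hw
    exact absurd hw.symm (of_ne_one i)
  | [l] => exact ⟨l, by rw [← hw, hL, lift_mk_singleton]⟩
  | _ :: _ :: _ => simp [hL] at hlen

end IsMinimalCounterexample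

theorem not_isMinimalCounterexample (u v : FreeGroup (Fin 2)) :
    ¬ IsMinimalCounterexample u v := by
  intro h
  obtain ⟨l, hl⟩ := h.exists_letterImage_eq_of 0
  obtain ⟨m, hm⟩ := h.exists_letterImage_eq_of 1
  have hinv : ∀ (k : Fin 2 × Bool) (i : Fin 2), letterImage ![u, v] k = of i →
      (invGenerators (![u, v] k.1))⁻¹ = ![u, v] k.1 := by
    rintro ⟨j, b⟩ i hk
    cases b
    · have : ![u, v] j = (of i)⁻¹ := by rw [← hk]; simp [letterImage]
      simp [this]
    · have : ![u, v] j = of i := hk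
      simp [this]
  have hlm : l.1 ≠ m.1 := by
    intro hlm
    have hne : (of 0 : FreeGroup (Fin 2)) ≠ of 1 ∧ (of 0 : FreeGroup (Fin 2)) ≠ (of 1)⁻¹ := by
      decide
    obtain ⟨i, b⟩ := l
    obtain ⟨j, c⟩ := m
    obtain rfl : i = j := hlm
    rw [← hl, ← hm] at hne
    cases b <;> cases c <;> simp [letterImage] at hne
  have hl' := hinv l 0 hl
  have hm' := hinv m 1 hm
  have hall : ∀ i : Fin 2, (invGenerators (![u, v] i))⁻¹ = ![u, v] i := by
    intro i
    obtain rfl | rfl : i = l.1 ∨ i = m.1 := by lia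
    · exact hl'
    · exact hm'
  exact h.1.2 ⟨1, by simpa using hall 0, by simpa using hall 1⟩

theorem isReversalConj_of_closure_eq_top {u v : FreeGroup (Fin 2)}
    (h : Subgroup.closure {u, v} = ⊤) : IsReversalConj u v := by
  by_contra hn
  obtain ⟨u', v', h'⟩ := IsCounterexample.exists_minimal ⟨h, hn⟩
  exact not_isMinimalCounterexample u' v' h'

end MinimalCounterexample

end FreeGroup

/-- The conjugacy class of a primitive element of `F₂` is closed under
reversal: if `u` is primitive (the image of a basis element under some automorphism),
then the reversal of `u` (obtained by reversing its reduced word) is conjugate to `u`. -/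
theorem stmt_19 (u : FreeGroup (Fin 2))
    (hu : ∃ ψ : FreeGroup (Fin 2) ≃* FreeGroup (Fin 2), ψ (FreeGroup.of 0) = u) :
    ∃ x : FreeGroup (Fin 2),
      FreeGroup.mk (FreeGroup.toWord u).reverse = x⁻¹ * u * x := by
  obtain ⟨ψ, rfl⟩ := hu
  have hψ : Subgroup.closure {ψ (FreeGroup.of 0), ψ (FreeGroup.of 1)} = ⊤ := by
    have h : Set.range (FreeGroup.of : Fin 2 → FreeGroup (Fin 2)) =
        {FreeGroup.of 0, FreeGroup.of 1} := by
      ext x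
      simp [Fin.exists_fin_two, eq_comm]
    have := congrArg (Subgroup.map ψ.toMonoidHom) (FreeGroup.closure_range_of (Fin 2))
    rw [MonoidHom.map_closure, Subgroup.map_top_of_surjective _ ψ.surjective, h,
      Set.image_pair] at this
    exact this
  obtain ⟨c, hc, -⟩ := FreeGroup.isReversalConj_of_closure_eq_top hψ
  refine ⟨c⁻¹, ?_⟩
  rw [FreeGroup.mk_reverse, FreeGroup.mk_toWord, hc, inv_inv]
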